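/- arXiv:2005.08487 — 3 statements merged into one kernel-verified Lean document; each statement's English description precedes it below -/
import Mathlib

section
/- Let $a<b$ be real numbers and $d\geq 2$ an integer bit-depth. Set $C=\frac{b-a}{2(2^d-3)}$ and let $\mathcal{A}=\{a-2C, a, a+2C, \dots, b, b+2C\}$ be the equally spaced alphabet with spacing $2C$ (which has cardinality $2^d$). Then for every $N$ and every input array $y\in[a,b]^{N\times N}$, the two-dimensional Sigma Delta recursion $q_{i,j}=Q_{\mathcal{A}}(u_{i,j-1}+u_{i-1,j}-u_{i-1,j-1}+y_{i,j})$, $u_{i,j}=u_{i,j-1}+u_{i-1,j}-u_{i-1,j-1}+y_{i,j}-q_{i,j}$ (with the convention $u_{i,j}=0$ whenever $i=0$ or $j=0$) produces a state array satisfying $|u_{i,j}|\leq C$ for all $1\leq i,j\leq N$. -/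
open scoped BigOperators
open Finset Matrix

theorem exists_near_grid (a C z : ℝ) (n : ℕ) (h1 : a - 3 * C ≤ z)
    (h2 : z ≤ a - 3 * C + 2 * C * (n + 1)) :
    ∃ k : ℕ, k ≤ n ∧ |a + 2 * C * ((k : ℝ) - 1) - z| ≤ C := by
  induction n with
  | zero =>
    refine ⟨0, le_rfl, ?_⟩
    push_cast at *
    rw [abs_le]
    constructor <;> linarith
  | succ n ih =>
    by_cases h : z ≤ a - 3 * C + 2 * C * (n + 1)
    · obtain ⟨k, hk, hk'⟩ := ih h
      exact ⟨k, by omega, hk'⟩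
    · refine ⟨n + 1, le_rfl, ?_⟩
      push_cast at *
      rw [abs_le]
      constructor <;> nlinarith

/-- Stability of the 2D Sigma Delta quantization with the equally
spaced alphabet `{a-2C, a, a+2C, …, b, b+2C}` of cardinality `2^d`, where
`C = (b-a)/(2(2^d-3))`: all state variables satisfy `|u i j| ≤ C`. -/
theorem sigma_delta_2d_stability
    (a b : ℝ) (hab : a < b) (d : ℕ) (hd : 2 ≤ d)
    (C : ℝ) (hC : C = (b - a) / (2 * (2 ^ d - 3)))
    (A : Set ℝ)
    (hA : A = {z : ℝ | ∃ j : Fin (2 ^ d), z = a + 2 * C * (((j : ℕ) : ℝ) - 1)})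
    (Q : ℝ → ℝ)
    (hQmem : ∀ z, Q z ∈ A)
    (hQnear : ∀ z, ∀ c ∈ A, |Q z - z| ≤ |c - z|)
    (N : ℕ) (y u q : ℕ → ℕ → ℝ)
    (hy : ∀ i j, 1 ≤ i → i ≤ N → 1 ≤ j → j ≤ N → a ≤ y i j ∧ y i j ≤ b)
    (hu0 : ∀ i j, i = 0 ∨ j = 0 → u i j = 0)
    (hq : ∀ i j, 1 ≤ i → i ≤ N → 1 ≤ j → j ≤ N →
      q i j = Q (u i (j - 1) + u (i - 1) j - u (i - 1) (j - 1) + y i j))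
    (hu : ∀ i j, 1 ≤ i → i ≤ N → 1 ≤ j → j ≤ N →
      u i j = u i (j - 1) + u (i - 1) j - u (i - 1) (j - 1) + y i j - q i j) :
    ∀ i j, 1 ≤ i → i ≤ N → 1 ≤ j → j ≤ N → |u i j| ≤ C := by
  have hpow : (4 : ℝ) ≤ 2 ^ d := by
    calc (4 : ℝ) = 2 ^ 2 := by norm_num
      _ ≤ 2 ^ d := pow_le_pow_right₀ (by norm_num) hd
  have hpos : (0 : ℝ) < 2 * (2 ^ d - 3) := by linarith
  have hC0 : 0 < C := by rw [hC]; exact div_pos (by linarith) hpos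
  have hCb : C * (2 * (2 ^ d - 3)) = b - a := by
    rw [hC]; exact div_mul_cancel₀ _ hpos.ne'
  have hnear : ∀ z, a - 3 * C ≤ z → z ≤ b + 3 * C → |z - Q z| ≤ C := by
    intro z h1 h2
    have hn : 2 ^ d - 1 + 1 = 2 ^ d := Nat.sub_add_cancel Nat.one_le_two_pow
    have hn' : (((2 ^ d - 1 : ℕ) : ℝ) + 1) = 2 ^ d := by exact_mod_cast hn
    obtain ⟨k, hk, hk'⟩ := exists_near_grid a C z (2 ^ d - 1) h1 (by
      rw [hn']; linarith)
    have hmem : a + 2 * C * ((k : ℝ) - 1) ∈ A := by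
      rw [hA]
      exact ⟨⟨k, by omega⟩, rfl⟩
    rw [abs_sub_comm]
    exact (hQnear z _ hmem).trans hk'
  have main : ∀ i, i ≤ N → ∀ j, j ≤ N → |u i j| ≤ C := by
    intro i
    induction i with
    | zero => intro _ j _; rw [hu0 0 j (Or.inl rfl)]; simpa using hC0.le
    | succ i ihi =>
      intro hi j
      induction j with
      | zero => intro _; rw [hu0 _ 0 (Or.inr rfl)]; simpa using hC0.le
      | succ j ihj =>
        intro hj
        have e1 := abs_le.1 (ihj (by omega))
        have e2 := abs_le.1 (ihi (by omega) (j + 1) hj)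
        have e3 := abs_le.1 (ihi (by omega) j (by omega))
        have e4 := hy (i + 1) (j + 1) (by omega) hi (by omega) hj
        rw [hu (i + 1) (j + 1) (by omega) hi (by omega) hj,
          hq (i + 1) (j + 1) (by omega) hi (by omega) hj]
        simp only [Nat.add_sub_cancel]
        apply hnear <;> linarith [e1.1, e1.2, e2.1, e2.2, e3.1, e3.2, e4.1, e4.2]
  intro i j _ hi _ hj
  exact main i hi j hj
end

section
/- Let $a<b$ be real numbers and $d\geq 2$ an integer, and set $C=\frac{b-a}{2(2^d-3)}$. Let $\widetilde{\mathcal{A}}\subset\mathbb{R}$ be any alphabet with at most $2^d$ elements (not necessarily equally spaced). Define its stability constant $\widetilde{C}$ as the supremum, over all $N$ and all inputs $y\in[a,b]^{N\times N}$, of the maximal absolute value of the state variables $u_{i,j}$ produced by the two-dimensional Sigma Delta recursion with quantizer $Q_{\widetilde{\mathcal{A}}}$. Then $\widetilde{C}\geq C$. -/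
open scoped BigOperators
open Finset Matrix

namespace SD

/-- Reachable pairs (row 1, row 2) in a common column. -/
inductive Reach (a b : ℝ) (Q : ℝ → ℝ) : ℝ → ℝ → Prop
  | zero : Reach a b Q 0 0
  | step (r s r' s' y1 y2 : ℝ) (h : Reach a b Q r s) (h1 : a ≤ y1) (h2 : y1 ≤ b)
      (h3 : a ≤ y2) (h4 : y2 ≤ b) (hr : r' = r + y1 - Q (r + y1))
      (hs : s' = s + r' - r + y2 - Q (s + r' - r + y2)) : Reach a b Q r' s'

/-- The state array. -/
noncomputable def U (Q : ℝ → ℝ) (y : ℕ → ℕ → ℝ) : ℕ → ℕ → ℝ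
  | 0, _ => 0
  | _ + 1, 0 => 0
  | i + 1, j + 1 =>
    U Q y (i + 1) j + U Q y i (j + 1) - U Q y i j + y (i + 1) (j + 1)
      - Q (U Q y (i + 1) j + U Q y i (j + 1) - U Q y i j + y (i + 1) (j + 1))
  termination_by i j => (i, j)

theorem Reach.path {a b : ℝ} (hab : a ≤ b) {Q : ℝ → ℝ} {r s : ℝ} (h : Reach a b Q r s) :
    ∃ (n : ℕ) (y1 y2 f g : ℕ → ℝ), (∀ k, a ≤ y1 k ∧ y1 k ≤ b) ∧ (∀ k, a ≤ y2 k ∧ y2 k ≤ b) ∧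
      f 0 = 0 ∧ g 0 = 0 ∧ f n = r ∧ g n = s ∧
      ∀ k < n, f (k + 1) = f k + y1 (k + 1) - Q (f k + y1 (k + 1)) ∧
        g (k + 1) = g k + f (k + 1) - f k + y2 (k + 1)
          - Q (g k + f (k + 1) - f k + y2 (k + 1)) := by
  induction h with
  | zero =>
    exact ⟨0, fun _ => a, fun _ => a, fun _ => 0, fun _ => 0, fun _ => ⟨le_refl _, hab⟩,
      fun _ => ⟨le_refl _, hab⟩, rfl, rfl, rfl, rfl, fun k hk => absurd hk (Nat.not_lt_zero k)⟩
  | step r s r' s' z1 z2 h h1 h2 h3 h4 hr hs ih =>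
    obtain ⟨n, y1, y2, f, g, hy1, hy2, f0, g0, fn, gn, hk⟩ := ih
    refine ⟨n + 1, fun k => if k ≤ n then y1 k else z1, fun k => if k ≤ n then y2 k else z2,
      fun k => if k ≤ n then f k else r', fun k => if k ≤ n then g k else s',
      ?_, ?_, ?_, ?_, ?_, ?_, ?_⟩
    · intro k
      by_cases hkn : k ≤ n
      · simpa [hkn] using hy1 k
      · simp [hkn, h1, h2]
    · intro k
      by_cases hkn : k ≤ n
      · simpa [hkn] using hy2 k
      · simp [hkn, h3, h4]
    · simp [f0]
    · simp [g0]
    · simp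
    · simp
    · intro k hkn
      rcases Nat.lt_succ_iff_lt_or_eq.mp hkn with h' | h'
      · have e1 : k ≤ n := h'.le
        have e2 : k + 1 ≤ n := h'
        simpa [e1, e2] using hk k h'
      · subst h'
        simp [fn, gn, ← hr, ← hs]

/-- The situation we study. -/
structure Sys (a b K : ℝ) (A : Finset ℝ) (Q : ℝ → ℝ) : Prop where
  mem : ∀ z, Q z ∈ A
  near : ∀ z, ∀ c ∈ A, |Q z - z| ≤ |c - z|
  stab : ∀ r s, Reach a b Q r s → |r| ≤ K ∧ |s| ≤ K
  len : 2 * K < b - a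
  hab : a < b

theorem Reach.neg {a b : ℝ} {Q : ℝ → ℝ} {r s : ℝ}
    (h : Reach (-b) (-a) (fun z => -Q (-z)) r s) : Reach a b Q (-r) (-s) := by
  induction h with
  | zero => simpa using Reach.zero
  | step r s r' s' y1 y2 h h1 h2 h3 h4 hr hs ih =>
    refine Reach.step (-r) (-s) (-r') (-s') (-y1) (-y2) ih (by linarith) (by linarith)
      (by linarith) (by linarith) ?_ ?_
    · rw [show -r + -y1 = -(r + y1) by ring]
      linarith
    · rw [show -s + -r' - -r + -y2 = -(s + r' - r + y2) by ring]
      linarith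

theorem Sys.neg {a b K : ℝ} {A : Finset ℝ} {Q : ℝ → ℝ} (S : Sys a b K A Q) :
    Sys (-b) (-a) K (A.image (fun x => -x)) (fun z => -Q (-z)) where
  mem z := mem_image.2 ⟨_, S.mem _, rfl⟩
  near z c hc := by
    obtain ⟨c', hc', rfl⟩ := mem_image.1 hc
    have := S.near (-z) c' hc'
    rw [show -Q (-z) - z = -(Q (-z) - -z) + -(2*z) + 2*z by ring]
    rw [show -c' - z = -(c' - -z) by ring, abs_neg]
    rw [show -(Q (-z) - -z) + -(2*z) + 2*z = -(Q (-z) - -z) by ring, abs_neg]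
    exact this
  stab r s h := by
    have := S.stab _ _ h.neg
    simpa using this
  len := by linarith [S.len]
  hab := by linarith [S.hab]

/-- consecutive letters -/
def Cons (A : Finset ℝ) (c c' : ℝ) : Prop := c ∈ A ∧ c' ∈ A ∧ c < c' ∧ ∀ t ∈ A, t ≤ c ∨ c' ≤ t

theorem Cons.neg {A : Finset ℝ} {c c' : ℝ} (h : Cons A c c') :
    Cons (A.image (fun x => -x)) (-c') (-c) := by
  obtain ⟨h1, h2, h3, h4⟩ := h
  refine ⟨mem_image.2 ⟨_, h2, rfl⟩, mem_image.2 ⟨_, h1, rfl⟩, by linarith, ?_⟩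
  intro t ht
  obtain ⟨t', ht', rfl⟩ := mem_image.1 ht
  rcases h4 t' ht' with h | h
  · right; linarith
  · left; linarith

theorem image_neg_neg (A : Finset ℝ) : (A.image (fun x => -x)).image (fun x => -x) = A := by
  ext x; simp

theorem exists_next {A : Finset ℝ} {c t : ℝ} (hc : c ∈ A) (ht : t ∈ A) (h : c < t) :
    ∃ c', Cons A c c' ∧ c' ≤ t := by
  have hne : (A.filter (fun x => c < x)).Nonempty := ⟨t, by simp [ht, h]⟩
  obtain ⟨m, hm, hmin⟩ := exists_min_image _ id hne
  simp only [mem_filter, id] at hm hmin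
  refine ⟨m, ⟨hc, hm.1, hm.2, ?_⟩, hmin t ⟨ht, h⟩⟩
  intro x hx
  by_cases hxc : x ≤ c
  · exact Or.inl hxc
  · exact Or.inr (hmin x ⟨hx, not_le.1 hxc⟩)

section
variable {a b K : ℝ} {A : Finset ℝ} {Q : ℝ → ℝ}

theorem Sys.le_of_lt (S : Sys a b K A Q) {c c' v : ℝ} (h : Cons A c c') (hv : v < (c + c') / 2) :
    Q v ≤ c := by
  rcases h.2.2.2 _ (S.mem v) with h1 | h1
  · exact h1
  · exfalso
    have h2 := S.near v c h.1
    have h3 := h.2.2.1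
    rw [abs_of_nonneg (by linarith)] at h2
    rcases abs_cases (c - v) with h4 | h4 <;> linarith

theorem Sys.ge_of_gt (S : Sys a b K A Q) {c c' v : ℝ} (h : Cons A c c') (hv : (c + c') / 2 < v) :
    c' ≤ Q v := by
  rcases h.2.2.2 _ (S.mem v) with h1 | h1
  · exfalso
    have h2 := S.near v c' h.2.1
    have h3 := h.2.2.1
    rw [abs_of_nonpos (by linarith)] at h2
    rcases abs_cases (c' - v) with h4 | h4 <;> linarith
  · exact h1

/-- near the midpoint from the left -/
theorem Sys.left_res (S : Sys a b K A Q) {c c' e : ℝ} (h : Cons A c c') (he : 0 < e)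
    (he2 : e ≤ (c' - c) / 2) :
    ((c + c') / 2 - e) - Q ((c + c') / 2 - e) = (c' - c) / 2 - e := by
  have h1 := S.le_of_lt h (v := (c + c') / 2 - e) (by linarith)
  have h2 := S.near ((c + c') / 2 - e) c h.1
  rw [abs_of_nonpos (by linarith), abs_of_nonpos (by linarith)] at h2
  linarith

theorem Sys.right_res (S : Sys a b K A Q) {c c' e : ℝ} (h : Cons A c c') (he : 0 < e)
    (he2 : e ≤ (c' - c) / 2) :
    ((c + c') / 2 + e) - Q ((c + c') / 2 + e) = -((c' - c) / 2 - e) := by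
  have h1 := S.ge_of_gt h (v := (c + c') / 2 + e) (by linarith)
  have h2 := S.near ((c + c') / 2 + e) c' h.2.1
  rw [abs_of_nonneg (by linarith), abs_of_nonneg (by linarith)] at h2
  linarith

theorem Sys.mono (S : Sys a b K A Q) {v w : ℝ} (h : v ≤ w) : Q v ≤ Q w := by
  rcases h.eq_or_lt with rfl | h
  · exact le_refl _
  by_contra! hc
  have h1 := S.near v _ (S.mem w)
  have h2 := S.near w _ (S.mem v)
  rcases abs_cases (Q v - v) with h3 | h3 <;> rcases abs_cases (Q w - v) with h4 | h4 <;>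
  rcases abs_cases (Q v - w) with h5 | h5 <;> rcases abs_cases (Q w - w) with h6 | h6 <;>
  linarith

/-- row-1 residuals from reachable states are bounded -/
theorem Sys.bd (S : Sys a b K A Q) {r s y : ℝ} (h : Reach a b Q r s) (h1 : a ≤ y) (h2 : y ≤ b) :
    |r + y - Q (r + y)| ≤ K :=
  (S.stab _ _ (Reach.step r s _ _ y y h h1 h2 h1 h2 rfl rfl)).1

theorem Sys.K_nonneg (S : Sys a b K A Q) : 0 ≤ K := by
  have := (S.stab _ _ Reach.zero).1
  simpa using this

/-- there is a letter `≤ a` -/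
theorem Sys.exists_le (S : Sys a b K A Q) : ∃ c ∈ A, c ≤ a := by
  by_contra! hc
  obtain ⟨m, hm, hmin⟩ := exists_min_image A id ⟨_, S.mem 0⟩
  simp only [id] at hmin
  have hpos : 0 < m - a := by linarith [hc m hm]
  have key : ∀ n : ℕ, ∃ r s, Reach a b Q r s ∧ r ≤ -(n * (m - a)) := by
    intro n
    induction n with
    | zero => exact ⟨0, 0, Reach.zero, by simp⟩
    | succ n ih =>
      obtain ⟨r, s, h, hr⟩ := ih
      refine ⟨_, _, Reach.step r s _ _ a a h le_rfl S.hab.le le_rfl S.hab.le rfl rfl, ?_⟩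
      have := hmin _ (S.mem (r + a))
      push_cast
      linarith
  obtain ⟨n, hn⟩ := exists_nat_gt (K / (m - a))
  obtain ⟨r, s, h, hr⟩ := key n
  have h1 := (abs_le.1 (S.stab _ _ h).1).1
  rw [div_lt_iff₀ hpos] at hn
  linarith

theorem Sys.exists_ge (S : Sys a b K A Q) : ∃ c ∈ A, b ≤ c := by
  obtain ⟨c, hc, h⟩ := S.neg.exists_le
  obtain ⟨c', hc', rfl⟩ := mem_image.1 hc
  exact ⟨c', hc', by linarith⟩

/-- holding -/
theorem Sys.hold (S : Sys a b K A Q) {r y c : ℝ} (h : Reach a b Q r r) (h1 : a ≤ y) (h2 : y ≤ b)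
    (hc1 : a ≤ c) (hc2 : c ≤ b)
    (hc : Q ((r + y - Q (r + y)) + c) = c) :
    Reach a b Q (r + y - Q (r + y)) (r + y - Q (r + y)) := by
  refine Reach.step r r _ _ y c h h1 h2 hc1 hc2 rfl ?_
  rw [show r + (r + y - Q (r + y)) - r + c = (r + y - Q (r + y)) + c by ring, hc]
  ring

theorem Sys.res_mid (S : Sys a b K A Q) {c c' v : ℝ} (h : Cons A c c') (h1 : c ≤ v)
    (h2 : v < (c + c') / 2) : Q v = c := by
  have h3 := S.le_of_lt h h2
  have h4 := S.near v c h.1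
  rw [abs_of_nonpos (by linarith), abs_of_nonpos (by linarith)] at h4
  linarith

theorem Sys.gap_up (S : Sys a b K A Q) {c c' : ℝ} (h : Cons A c c') (hcb : c < b)
    (hm : b ≤ (c + c') / 2) :
    ∃ u, Reach a b Q u u ∧ u + a < (c + c') / 2 ∧ (c + c') / 2 < u + b := by
  have hK := S.K_nonneg
  have hlen := S.len
  have hca : a ≤ c := by
    by_contra! hca
    have h1 := S.bd Reach.zero S.hab.le le_rfl
    rw [zero_add] at h1
    have h2 := abs_le.1 h1
    rcases h.2.2.2 _ (S.mem b) with h3 | h3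
    · linarith
    · linarith
  set m := (c + c') / 2 with hmdef
  set b' := (c + b) / 2 with hb'
  have hbc : 0 < b' - c := by simp only [hb']; linarith
  have hb'b : b' < b := by simp only [hb']; linarith
  by_contra! hcon
  have hcon' : ∀ u, Reach a b Q u u → u + b ≤ m := by
    intro u hu
    have h1 := abs_le.1 (S.stab _ _ hu).1
    exact hcon u hu (by linarith)
  have key : ∀ n : ℕ, Reach a b Q (n * (b' - c)) (n * (b' - c)) := by
    intro n
    induction n with
    | zero => simpa using Reach.zero
    | succ n ih =>
      have h0 : 0 ≤ n * (b' - c) := by positivity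
      have h1 := hcon' _ ih
      have h2 : Q (n * (b' - c) + b') = c := S.res_mid h (by linarith) (by linarith)
      have h3 : n * (b' - c) + b' - Q (n * (b' - c) + b') = (n + 1 : ℕ) * (b' - c) := by
        rw [h2]; push_cast; ring
      rw [← h3]
      refine S.hold ih (by linarith) (by linarith) hca hcb.le ?_
      rw [h2]
      exact S.res_mid h (by linarith) (by linarith)
  obtain ⟨n, hn⟩ := exists_nat_gt (K / (b' - c))
  have h1 := (abs_le.1 (S.stab _ _ (key n)).1).2
  rw [div_lt_iff₀ hbc] at hn
  linarith

theorem Sys.gap (S : Sys a b K A Q) {c c' : ℝ} (h : Cons A c c') (hcb : c < b) (hca : a < c') :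
    ∃ u, Reach a b Q u u ∧ u + a < (c + c') / 2 ∧ (c + c') / 2 < u + b := by
  by_cases h1 : b ≤ (c + c') / 2
  · exact S.gap_up h hcb h1
  by_cases h2 : (c + c') / 2 ≤ a
  · obtain ⟨u, hu, h3, h4⟩ := S.neg.gap_up h.neg (by linarith) (by linarith)
    exact ⟨-u, hu.neg, by linarith, by linarith⟩
  · exact ⟨0, Reach.zero, by linarith, by linarith⟩

theorem Sys.gap_le (S : Sys a b K A Q) {c c' : ℝ} (h : Cons A c c') (hcb : c < b) (hca : a < c') :
    c' - c ≤ 2 * K := by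
  obtain ⟨u, hu, h1, h2⟩ := S.gap h hcb hca
  have h3 := S.bd hu (y := (c + c') / 2 - u) (by linarith) (by linarith)
  rw [show u + ((c + c') / 2 - u) = (c + c') / 2 by ring] at h3
  have h4 := abs_le.1 h3
  rcases h.2.2.2 _ (S.mem ((c + c') / 2)) with h5 | h5 <;> linarith

/-- each window contains a midpoint -/
theorem Sys.window (S : Sys a b K A Q) {x s e : ℝ} (hx : Reach a b Q x s) (he : 0 < e) :
    ∃ c c' y, Cons A c c' ∧ x + a ≤ (c + c') / 2 ∧ (c + c') / 2 ≤ x + b ∧ a ≤ y ∧ y ≤ b ∧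
      (c' - c) / 2 - e ≤ x + y - Q (x + y) := by
  have h1 := abs_le.1 (S.bd hx le_rfl S.hab.le)
  have h2 := abs_le.1 (S.bd hx S.hab.le le_rfl)
  have hlen := S.len
  have hlt : Q (x + a) < Q (x + b) := by
    rcases (S.mono (show x + a ≤ x + b by linarith)).eq_or_lt with h | h
    · linarith
    · exact h
  obtain ⟨c', hc, hc'⟩ := exists_next (S.mem _) (S.mem _) hlt
  have ha : x + a ≤ (Q (x + a) + c') / 2 := by
    by_contra! h
    have := S.ge_of_gt hc h
    linarith [hc.2.2.1]
  have hb : (Q (x + a) + c') / 2 ≤ x + b := by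
    by_contra! h
    have := S.le_of_lt hc h
    linarith
  by_cases h : x + a ≤ (Q (x + a) + c') / 2 - e
  · refine ⟨_, c', (Q (x + a) + c') / 2 - e - x, hc, ha, hb, by linarith, by linarith, ?_⟩
    rw [show x + ((Q (x + a) + c') / 2 - e - x) = (Q (x + a) + c') / 2 - e by ring]
    have := S.le_of_lt hc (v := (Q (x + a) + c') / 2 - e) (by linarith)
    linarith
  · refine ⟨_, c', a, hc, ha, hb, le_rfl, S.hab.le, ?_⟩
    linarith

/-- the 2x2 pattern -/
theorem Sys.pattern (S : Sys a b K A Q) {u x z y e : ℝ} (hu : Reach a b Q u u)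
    (hz1 : a ≤ z) (hz2 : z ≤ b) (hx : x = u + z - Q (u + z))
    (hy1 : a ≤ y) (hy2 : y ≤ b) (he : e ≤ x + y - Q (x + y)) :
    ∃ t ∈ A, b + 2 * e - x - K ≤ t := by
  have r1 : Reach a b Q x (x + y - Q (x + y)) := by
    refine Reach.step u u _ _ z y hu hz1 hz2 hy1 hy2 hx ?_
    rw [show u + x - u + y = x + y by ring]
  have r2 := Reach.step _ _ _ _ y b r1 hy1 hy2 S.hab.le le_rfl rfl rfl
  have h := abs_le.1 (S.stab _ _ r2).2
  exact ⟨_, S.mem (x + y - Q (x + y) + (x + y - Q (x + y)) - x + b), by linarith [h.2]⟩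

end

/-- `Top` data for a gap -/
def Top (b K G e : ℝ) (A : Finset ℝ) (c c' : ℝ) : Prop :=
  Cons A c c' ∧ c' - c ≤ G ∧ ∃ t ∈ A, b + (c' - c) + G / 2 - 3 * e - K ≤ t

section
variable {a b K : ℝ} {A : Finset ℝ} {Q : ℝ → ℝ}

/-- If `(c0,c0')` is the maximal gap meeting `(a,b)`. -/
theorem Sys.top (S : Sys a b K A Q) {c0 c0' e : ℝ} (h0 : Cons A c0 c0')
    (hmax : ∀ c c', Cons A c c' → c < b → a < c' → c' - c ≤ c0' - c0)
    (he0 : 0 < e) (heG : e < (c0' - c0) / 2)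
    (he1 : ∃ u, Reach a b Q u u ∧ u + a < (c0 + c0') / 2 ∧ (c0 + c0') / 2 + e < u + b) :
    (∃ c c', Top b K (c0' - c0) e A c c' ∧ a - (c0' - c0) / 2 ≤ (c + c') / 2 ∧
      (c + c') / 2 ≤ b + (c0' - c0) / 2) ∧
    (a - (c0' - c0) / 2 + e < (c0 + c0') / 2 → (c0 + c0') / 2 ≤ b - (c0' - c0) / 2 + e →
      Top b K (c0' - c0) e A c0 c0') := by
  obtain ⟨u, hu, hua, hub⟩ := he1
  set x := -((c0' - c0) / 2 - e) with hxdef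
  have hx : x = u + ((c0 + c0') / 2 + e - u) - Q (u + ((c0 + c0') / 2 + e - u)) := by
    rw [show u + ((c0 + c0') / 2 + e - u) = (c0 + c0') / 2 + e by ring]
    exact (S.right_res h0 he0 heG.le).symm
  have hz1 : a ≤ (c0 + c0') / 2 + e - u := by linarith
  have hz2 : (c0 + c0') / 2 + e - u ≤ b := by linarith
  have hxr : ∃ s, Reach a b Q x s :=
    ⟨_, Reach.step u u _ _ _ _ hu hz1 hz2 hz1 hz2 hx rfl⟩
  obtain ⟨s, hxs⟩ := hxr
  constructor
  · obtain ⟨c, c', y, hc, h1, h2, hy1, hy2, hy⟩ := S.window hxs he0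
    obtain ⟨t, ht, htb⟩ := S.pattern hu hz1 hz2 hx hy1 hy2 hy
    refine ⟨c, c', ⟨hc, ?_, t, ht, by linarith⟩, by linarith, by linarith⟩
    by_cases hcb : c < b
    · by_cases hca : a < c'
      · exact hmax c c' hc hcb hca
      · linarith
    · linarith [hc.2.2.1]
  · intro h1 h2
    refine ⟨h0, le_rfl, ?_⟩
    have hy : ∃ y, a ≤ y ∧ y ≤ b ∧ (c0' - c0) / 2 - e ≤ x + y - Q (x + y) := by
      by_cases h : x + a ≤ (c0 + c0') / 2 - e
      · refine ⟨(c0 + c0') / 2 - e - x, by linarith, by linarith, ?_⟩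
        rw [show x + ((c0 + c0') / 2 - e - x) = (c0 + c0') / 2 - e by ring]
        exact (S.left_res h0 he0 heG.le).ge
      · refine ⟨a, le_rfl, S.hab.le, ?_⟩
        have := S.le_of_lt h0 (v := x + a) (by linarith)
        linarith
    obtain ⟨y, hy1, hy2, hy⟩ := hy
    obtain ⟨t, ht, htb⟩ := S.pattern hu hz1 hz2 hx hy1 hy2 hy
    exact ⟨t, ht, by linarith⟩

end

theorem count {A : Finset ℝ} {G : ℝ} (hG : 0 ≤ G) (n : ℕ) : ∀ x z, x ∈ A → z ∈ A → x ≤ z →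
    (∀ t ∈ A, x ≤ t → t < z → ∃ t' ∈ A, t < t' ∧ t' ≤ t + G) →
    (A.filter (fun t => x ≤ t ∧ t ≤ z)).card ≤ n → z - x ≤ (n - 1) * G := by
  induction n with
  | zero =>
    intro x z hx hz hxz _ hcard
    have : x ∈ A.filter (fun t => x ≤ t ∧ t ≤ z) := by simp [hx, hxz]
    have := card_pos.2 ⟨x, this⟩
    omega
  | succ n ih =>
    intro x z hx hz hxz hgap hcard
    rcases hxz.eq_or_lt with rfl | hlt
    · push_cast
      simp only [sub_self, add_sub_cancel_right]
      positivity
    have : ∃ t' ∈ A, x < t' ∧ t' ≤ x + G ∧ t' ≤ z := by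
      obtain ⟨t', h1, h2, h3⟩ := hgap x hx le_rfl hlt
      by_cases h : t' ≤ z
      · exact ⟨t', h1, h2, h3, h⟩
      · exact ⟨z, hz, hlt, by linarith, le_rfl⟩
    obtain ⟨t', h1, h2, h3, h4⟩ := this
    have hsub : A.filter (fun t => t' ≤ t ∧ t ≤ z) ⊂ A.filter (fun t => x ≤ t ∧ t ≤ z) := by
      rw [Finset.ssubset_iff_of_subset]
      · exact ⟨x, by simp [hx, hxz], by simp [h2]⟩
      · intro t
        simp only [mem_filter]
        rintro ⟨p1, p2, p3⟩
        exact ⟨p1, by linarith, p3⟩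
    have hc := card_lt_card hsub
    have := ih t' z h1 hz h4 (fun t ht h5 h6 => hgap t ht (by linarith) h6) (by omega)
    push_cast
    linarith

theorem count2 {A : Finset ℝ} {G : ℝ} (hG : 0 ≤ G) {x z c c' : ℝ} (hx : x ∈ A) (hz : z ∈ A)
    (hgap : ∀ t ∈ A, x ≤ t → t < z → ∃ t' ∈ A, t < t' ∧ t' ≤ t + G)
    (hc : Cons A c c') (hxc : x ≤ c) (hcz : c' ≤ z) :
    z - x ≤ ((A.filter (fun t => x ≤ t ∧ t ≤ z)).card - 2) * G + (c' - c) := by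
  have hlt := hc.2.2.1
  have h1 := count hG _ x c hx hc.1 hxc (fun t ht h5 h6 => hgap t ht h5 (by linarith)) le_rfl
  have h2 := count hG _ c' z hc.2.1 hz hcz (fun t ht h5 h6 => hgap t ht (by linarith) h6) le_rfl
  have hd : Disjoint (A.filter (fun t => x ≤ t ∧ t ≤ c)) (A.filter (fun t => c' ≤ t ∧ t ≤ z)) := by
    rw [Finset.disjoint_left]
    intro t
    simp only [mem_filter]
    rintro ⟨_, _, p⟩ ⟨_, p', _⟩
    linarith
  have hu := card_union_of_disjoint hd
  have hs : A.filter (fun t => x ≤ t ∧ t ≤ c) ∪ A.filter (fun t => c' ≤ t ∧ t ≤ z) ⊆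
      A.filter (fun t => x ≤ t ∧ t ≤ z) := by
    intro t
    simp only [mem_union, mem_filter]
    rintro (⟨p1, p2, p3⟩ | ⟨p1, p2, p3⟩)
    · exact ⟨p1, p2, by linarith⟩
    · exact ⟨p1, by linarith, p3⟩
  have hcard := card_le_card hs
  rw [hu] at hcard
  have hcard' : ((A.filter (fun t => x ≤ t ∧ t ≤ c)).card : ℝ)
      + (A.filter (fun t => c' ≤ t ∧ t ≤ z)).card ≤
      (A.filter (fun t => x ≤ t ∧ t ≤ z)).card := by exact_mod_cast hcard
  nlinarith [mul_le_mul_of_nonneg_right hcard' hG]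

/-- upper cut-off letter -/
theorem exists_cut {A : Finset ℝ} {b G : ℝ} (hA : ∃ t ∈ A, b ≤ t) :
    ∃ z ∈ A, b ≤ z ∧ (∀ t ∈ A, t ≤ z ∨ z + G < t) ∧
      (∀ t ∈ A, b ≤ t → t < z → ∃ t' ∈ A, t < t' ∧ t' ≤ t + G) := by
  have hne : (A.filter (fun z => b ≤ z ∧ ∀ t ∈ A, t ≤ z ∨ z + G < t)).Nonempty := by
    obtain ⟨t, ht, hb⟩ := hA
    obtain ⟨m, hm, hmax⟩ := exists_max_image A id ⟨t, ht⟩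
    refine ⟨m, mem_filter.2 ⟨hm, hb.trans (hmax t ht), fun t ht => Or.inl (hmax t ht)⟩⟩
  obtain ⟨z, hz, hmin⟩ := exists_min_image _ id hne
  simp only [mem_filter, id] at hz hmin
  refine ⟨z, hz.1, hz.2.1, hz.2.2, ?_⟩
  intro t ht hbt htz
  by_contra! hcon
  have := hmin t ⟨ht, hbt, fun t' ht' => by
    by_cases h : t' ≤ t
    · exact Or.inl h
    · exact Or.inr (hcon t' ht' (not_le.1 h))⟩
  linarith

theorem exists_cut' {A : Finset ℝ} {a G : ℝ} (hA : ∃ t ∈ A, t ≤ a) :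
    ∃ z ∈ A, z ≤ a ∧ (∀ t ∈ A, z ≤ t ∨ t < z - G) ∧
      (∀ t ∈ A, t ≤ a → z < t → ∃ t' ∈ A, t' < t ∧ t - G ≤ t') := by
  obtain ⟨t, ht, hta⟩ := hA
  obtain ⟨z, hz, h1, h2, h3⟩ := exists_cut (A := A.image (fun x => -x)) (b := -a) (G := G)
    ⟨-t, mem_image.2 ⟨t, ht, rfl⟩, by linarith⟩
  obtain ⟨s, hs, rfl⟩ := mem_image.1 hz
  refine ⟨s, hs, by linarith, ?_, ?_⟩
  · intro t ht
    rcases h2 (-t) (mem_image.2 ⟨t, ht, rfl⟩) with h | h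
    · left; linarith
    · right; linarith
  · intro t ht hta hst
    obtain ⟨t', ht', h4, h5⟩ := h3 (-t) (mem_image.2 ⟨t, ht, rfl⟩) (by linarith) (by linarith)
    obtain ⟨w, hw, rfl⟩ := mem_image.1 ht'
    exact ⟨w, hw, by linarith, by linarith⟩

section
variable {a b K : ℝ} {A : Finset ℝ} {Q : ℝ → ℝ}

theorem Cons.neg' {A : Finset ℝ} {c c' : ℝ} (h : Cons (A.image (fun x => -x)) c c') :
    Cons A (-c') (-c) := by
  have := h.neg
  rwa [image_neg_neg] at this

theorem Sys.bot (S : Sys a b K A Q) {c0 c0' e : ℝ} (h0 : Cons A c0 c0')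
    (hmax : ∀ c c', Cons A c c' → c < b → a < c' → c' - c ≤ c0' - c0)
    (he0 : 0 < e) (heG : e < (c0' - c0) / 2)
    (he1 : ∃ u, Reach (-b) (-a) (fun z => -Q (-z)) u u ∧
      -u + a < (c0 + c0') / 2 - e ∧ (c0 + c0') / 2 < -u + b) :
    (∃ c c', Cons A c c' ∧ c' - c ≤ c0' - c0 ∧
      (∃ t ∈ A, t ≤ a - (c' - c) - (c0' - c0) / 2 + 3 * e + K) ∧
      a - (c0' - c0) / 2 ≤ (c + c') / 2 ∧ (c + c') / 2 ≤ b + (c0' - c0) / 2) ∧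
    ((c0 + c0') / 2 < b + (c0' - c0) / 2 - e → a + (c0' - c0) / 2 - e ≤ (c0 + c0') / 2 →
      ∃ t ∈ A, t ≤ a - (c0' - c0) - (c0' - c0) / 2 + 3 * e + K) := by
  obtain ⟨u, hu, h1, h2⟩ := he1
  have key := S.neg.top h0.neg (e := e)
    (fun c c' hc hcb hca => by
      have := hmax _ _ hc.neg' (by linarith) (by linarith)
      linarith) he0 (by linarith) ⟨u, hu, by linarith, by linarith⟩
  obtain ⟨⟨c, c', ⟨hc, hcG, t, ht, htb⟩, h3, h4⟩, k2⟩ := key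
  constructor
  · obtain ⟨w, hw, rfl⟩ := mem_image.1 ht
    exact ⟨-c', -c, hc.neg', by linarith, ⟨w, hw, by linarith⟩, by linarith, by linarith⟩
  · intro h5 h6
    obtain ⟨_, _, t', ht', htb'⟩ := k2 (by linarith) (by linarith)
    obtain ⟨w, hw, rfl⟩ := mem_image.1 ht'
    exact ⟨w, hw, by linarith⟩

theorem Sys.max_gap (S : Sys a b K A Q) : ∃ c0 c0', Cons A c0 c0' ∧ c0 < b ∧ a < c0' ∧
    ∀ c c', Cons A c c' → c < b → a < c' → c' - c ≤ c0' - c0 := by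
  classical
  have hne : ((A ×ˢ A).filter (fun p => Cons A p.1 p.2 ∧ p.1 < b ∧ a < p.2)).Nonempty := by
    obtain ⟨l, hl, hla⟩ := S.exists_le
    obtain ⟨h, hh, hhb⟩ := S.exists_ge
    obtain ⟨m, hm, hmax⟩ := exists_max_image (A.filter (fun t => t ≤ a)) id ⟨l, by simp [hl, hla]⟩
    simp only [mem_filter, id] at hm hmax
    have hab := S.hab
    obtain ⟨c', hc', _⟩ := exists_next hm.1 hh (by linarith)
    refine ⟨(m, c'), mem_filter.2 ⟨mem_product.2 ⟨hm.1, hc'.2.1⟩, hc', by linarith, ?_⟩⟩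
    by_contra! hcon
    have := hmax c' ⟨hc'.2.1, hcon⟩
    linarith [hc'.2.2.1]
  obtain ⟨p, hp, hmax⟩ := exists_max_image _ (fun p => p.2 - p.1) hne
  simp only [mem_filter, mem_product] at hp hmax
  exact ⟨p.1, p.2, hp.2.1, hp.2.2.1, hp.2.2.2,
    fun c c' hc h1 h2 => hmax (c, c') ⟨⟨hc.1, hc.2.1⟩, hc, h1, h2⟩⟩

theorem Reach.neg_symm {a b : ℝ} {Q : ℝ → ℝ} {r s : ℝ}
    (h : Reach a b Q r s) : Reach (-b) (-a) (fun z => -Q (-z)) (-r) (-s) := by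
  apply Reach.neg
  simpa using h

theorem Sys.false (S : Sys a b K A Q) {M : ℕ} (hM : 4 ≤ M) (hcard : A.card ≤ M)
    (hK : (M - 3) * (2 * K) < b - a) : False := by
  obtain ⟨c0, c0', h0, h0b, h0a, hmax⟩ := S.max_gap
  have hG2 := S.gap_le h0 h0b h0a
  obtain ⟨u, hu, hua, hub⟩ := S.gap h0 h0b h0a
  have hlen := S.len
  have hab := S.hab
  have hGpos : 0 < c0' - c0 := by linarith [h0.2.2.1]
  obtain ⟨e, he0, heG, e1, e2, e3, e4, e5⟩ : ∃ e, 0 < e ∧ e < (c0' - c0) / 2 ∧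
      e < (c0 + c0') / 2 - (u + a) ∧ e < u + b - (c0 + c0') / 2 ∧ e < c0' - a ∧ e < b - c0 ∧
      e < (b - a - (M - 3) * (2 * K)) / 6 := by
    have hp : 0 < min ((c0' - c0) / 2) (min ((c0 + c0') / 2 - (u + a))
        (min (u + b - (c0 + c0') / 2) (min (c0' - a) (min (b - c0)
          ((b - a - (M - 3) * (2 * K)) / 6))))) := by
      simp only [lt_min_iff]
      refine ⟨?_, ?_, ?_, ?_, ?_, ?_⟩ <;> linarith
    obtain ⟨e, he0, he⟩ := exists_between hp
    simp only [lt_min_iff] at he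
    exact ⟨e, he0, he⟩
  obtain ⟨⟨ct, ct', ⟨hct, hctG, t1, ht1, ht1b⟩, hct1, hct2⟩, top0⟩ :=
    S.top h0 hmax he0 heG ⟨u, hu, hua, by linarith⟩
  obtain ⟨⟨cb, cb', hcb, hcbG, ⟨t2, ht2, ht2a⟩, hcb1, hcb2⟩, bot0⟩ :=
    S.bot h0 hmax he0 heG ⟨-u, hu.neg_symm, by linarith, by linarith⟩
  have h00 : (∃ t ∈ A, b + (c0' - c0) + (c0' - c0) / 2 - 3 * e - K ≤ t) ∨
      ∃ t ∈ A, t ≤ a - (c0' - c0) - (c0' - c0) / 2 + 3 * e + K := by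
    by_cases h : (c0 + c0') / 2 ≤ b - (c0' - c0) / 2 + e
    · exact Or.inl (top0 (by linarith) h).2.2
    · exact Or.inr (bot0 (by linarith) (by linarith))
  clear top0 bot0
  set G := c0' - c0 with hGdef
  obtain ⟨z, hz, hbz, hz1, hz2⟩ := exists_cut (G := G) S.exists_ge
  obtain ⟨s, hs, hsa, hs1, hs2⟩ := exists_cut' (G := G) S.exists_le
  have hgap : ∀ t ∈ A, s ≤ t → t < z → ∃ t' ∈ A, t < t' ∧ t' ≤ t + G := by
    intro t ht hst htz
    by_cases hbt : b ≤ t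
    · exact hz2 t ht hbt htz
    obtain ⟨t', htt, _⟩ := exists_next ht hz htz
    by_cases hat : a < t'
    · exact ⟨t', htt.2.1, htt.2.2.1, by linarith [hmax t t' htt (by linarith) hat]⟩
    · obtain ⟨w, hw, h1, h2⟩ := hs2 t' htt.2.1 (by linarith) (by linarith [htt.2.2.1])
      refine ⟨t', htt.2.1, htt.2.2.1, ?_⟩
      rcases htt.2.2.2 w hw with h | h <;> linarith
  have inside : ∀ c c', Cons A c c' → c' - c ≤ G → a - G / 2 ≤ (c + c') / 2 →
      (c + c') / 2 ≤ b + G / 2 → s ≤ c ∧ c' ≤ z := by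
    intro c c' hc hg h1 h2
    have hlt := hc.2.2.1
    constructor
    · rcases hs1 c hc.1 with h | h
      · exact h
      · rcases hs1 c' hc.2.1 with h' | h' <;> linarith
    · rcases hz1 c' hc.2.1 with h | h
      · exact h
      · rcases hz1 c hc.1 with h' | h' <;> linarith
  obtain ⟨it1, it2⟩ := inside _ _ hct hctG hct1 hct2
  obtain ⟨ib1, ib2⟩ := inside _ _ hcb hcbG hcb1 hcb2
  have n1 := count2 hGpos.le hs hz hgap hct it1 it2
  have n2 := count2 hGpos.le hs hz hgap hcb ib1 ib2
  set F := A.filter (fun t => s ≤ t ∧ t ≤ z) with hF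
  have hFA : F ⊆ A := filter_subset _ _
  have hM' : (4 : ℝ) ≤ M := by exact_mod_cast hM
  have hprod : ((M : ℝ) - 4) * G ≤ (M - 4) * (2 * K) :=
    mul_le_mul_of_nonneg_left hG2 (by linarith)
  have hN : ∀ k : ℕ, F.card + k ≤ M → (F.card : ℝ) * G + k * G ≤ M * G := by
    intro k hk
    have : (F.card : ℝ) + k ≤ M := by exact_mod_cast hk
    nlinarith
  by_cases hzt : ∃ t ∈ A, z < t
  · obtain ⟨t, ht, hzt⟩ := hzt
    have htF : t ∉ F := by simp [hF, hzt]
    by_cases hst : ∃ t ∈ A, t < s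
    · obtain ⟨t', ht', hst⟩ := hst
      have htF' : t' ∉ F := by simp [hF, hst]
      have hne : t' ≠ t := by intro h; subst h; linarith
      have hsub : insert t' (insert t F) ⊆ A := by
        intro x; simp only [mem_insert]
        rintro (rfl | rfl | h)
        · exact ht'
        · exact ht
        · exact hFA h
      have hc := card_le_card hsub
      rw [card_insert_of_notMem (by simp [htF', hne]), card_insert_of_notMem htF] at hc
      have := hN 2 (by omega)
      push_cast at this
      linarith
    · push Not at hst
      have hsub : insert t F ⊆ A := by
        intro x; simp only [mem_insert]
        rintro (rfl | h)
        · exact ht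
        · exact hFA h
      have hc := card_le_card hsub
      rw [card_insert_of_notMem htF] at hc
      have := hN 1 (by omega)
      push_cast at this
      have := hst t2 ht2
      linarith
  · push Not at hzt
    by_cases hst : ∃ t ∈ A, t < s
    · obtain ⟨t', ht', hst⟩ := hst
      have htF' : t' ∉ F := by simp [hF, hst]
      have hsub : insert t' F ⊆ A := by
        intro x; simp only [mem_insert]
        rintro (rfl | h)
        · exact ht'
        · exact hFA h
      have hc := card_le_card hsub
      rw [card_insert_of_notMem htF'] at hc
      have := hN 1 (by omega)
      push_cast at this
      have := hzt t1 ht1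
      linarith
    · push Not at hst
      have hc := card_le_card hFA
      have := hN 0 (by omega)
      push_cast at this
      have := hst t2 ht2
      have := hzt t1 ht1
      rcases h00 with ⟨t, ht, h⟩ | ⟨t, ht, h⟩
      · have := hzt t ht
        linarith
      · have := hst t ht
        linarith

end

end SD


/-- Optimality of the stability constant `C = (b-a)/(2(2^d-3))`:
for any alphabet `Ã` with at most `2^d` elements, any constant `C̃` bounding all
state variables produced by the 2D Sigma Delta recursion with a nearest-point
quantizer for `Ã` (over all sizes `N` and all inputs `y ∈ [a,b]^{N×N}`) must
satisfy `C̃ ≥ C`. -/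
theorem sigma_delta_2d_optimal_alphabet
    (a b : ℝ) (hab : a < b) (d : ℕ) (hd : 2 ≤ d)
    (C : ℝ) (hC : C = (b - a) / (2 * (2 ^ d - 3)))
    (A : Finset ℝ) (hAne : A.Nonempty) (hcard : A.card ≤ 2 ^ d)
    (Ctil : ℝ)
    (hCtil : ∀ (N : ℕ) (y : ℕ → ℕ → ℝ),
      (∀ i j, 1 ≤ i → i ≤ N → 1 ≤ j → j ≤ N → a ≤ y i j ∧ y i j ≤ b) →
      ∀ (Q : ℝ → ℝ), (∀ z, Q z ∈ (A : Set ℝ)) →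
        (∀ z, ∀ c ∈ (A : Set ℝ), |Q z - z| ≤ |c - z|) →
      ∀ (u q : ℕ → ℕ → ℝ),
        (∀ i j, i = 0 ∨ j = 0 → u i j = 0) →
        (∀ i j, 1 ≤ i → i ≤ N → 1 ≤ j → j ≤ N →
          q i j = Q (u i (j - 1) + u (i - 1) j - u (i - 1) (j - 1) + y i j)) →
        (∀ i j, 1 ≤ i → i ≤ N → 1 ≤ j → j ≤ N →
          u i j = u i (j - 1) + u (i - 1) j - u (i - 1) (j - 1) + y i j - q i j) →
        ∀ i j, 1 ≤ i → i ≤ N → 1 ≤ j → j ≤ N → |u i j| ≤ Ctil) :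
    C ≤ Ctil := by
  by_contra! hlt
  -- a nearest-point quantizer
  have hex : ∀ z : ℝ, ∃ c ∈ A, ∀ c' ∈ A, |c - z| ≤ |c' - z| := fun z =>
    exists_min_image A (fun c => |c - z|) hAne
  choose Q hQ1 hQ2 using hex
  have hM : 4 ≤ 2 ^ d := by
    calc 4 = 2 ^ 2 := by norm_num
      _ ≤ 2 ^ d := Nat.pow_le_pow_right (by norm_num) hd
  have hM' : (4 : ℝ) ≤ 2 ^ d := by exact_mod_cast hM
  have stab : ∀ r s, SD.Reach a b Q r s → |r| ≤ Ctil ∧ |s| ≤ Ctil := by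
    intro r s h
    -- first pass to a nonempty path
    have main : ∀ r s, ∀ n : ℕ, ∀ y1 y2 f g : ℕ → ℝ, (∀ k, a ≤ y1 k ∧ y1 k ≤ b) →
        (∀ k, a ≤ y2 k ∧ y2 k ≤ b) → f 0 = 0 → g 0 = 0 → f n = r → g n = s →
        (∀ k < n, f (k + 1) = f k + y1 (k + 1) - Q (f k + y1 (k + 1)) ∧
        g (k + 1) = g k + f (k + 1) - f k + y2 (k + 1)
          - Q (g k + f (k + 1) - f k + y2 (k + 1))) → |r| ≤ Ctil ∧ |s| ≤ Ctil := by
      intro r s n y1 y2 f g hy1 hy2 f0 g0 fn gn hk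
      let y : ℕ → ℕ → ℝ := fun i j => if i = 1 then y1 j else if i = 2 then y2 j else a
      have hy : ∀ i j, a ≤ y i j ∧ y i j ≤ b := by
        intro i j
        simp only [y]
        split_ifs
        · exact hy1 j
        · exact hy2 j
        · exact ⟨le_rfl, hab.le⟩
      have hU0 : ∀ i, SD.U Q y i 0 = 0 := by
        intro i
        cases i <;> simp [SD.U]
      have hU0' : ∀ j, SD.U Q y 0 j = 0 := by
        intro j
        simp [SD.U]
      have hU : ∀ i j, SD.U Q y (i + 1) (j + 1) =
          SD.U Q y (i + 1) j + SD.U Q y i (j + 1) - SD.U Q y i j + y (i + 1) (j + 1)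
          - Q (SD.U Q y (i + 1) j + SD.U Q y i (j + 1) - SD.U Q y i j + y (i + 1) (j + 1)) := by
        intro i j
        rw [SD.U]
      have bound := hCtil (n + 2) y (fun i j _ _ _ _ => hy i j) Q (fun z => hQ1 z)
        (fun z c hc => hQ2 z c hc) (SD.U Q y)
        (fun i j => Q (SD.U Q y i (j - 1) + SD.U Q y (i - 1) j - SD.U Q y (i - 1) (j - 1) + y i j))
        (by
          rintro i j (rfl | rfl)
          · exact hU0' j
          · exact hU0 i)
        (fun i j _ _ _ _ => rfl)
        (by
          intro i j hi _ hj _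
          obtain ⟨i, rfl⟩ := Nat.exists_eq_add_of_le' hi
          obtain ⟨j, rfl⟩ := Nat.exists_eq_add_of_le' hj
          simpa using hU i j)
      have hf : ∀ k ≤ n, SD.U Q y 1 k = f k ∧ SD.U Q y 2 k = g k := by
        intro k
        induction k with
        | zero =>
          intro _
          rw [hU0, hU0, f0, g0]
          exact ⟨rfl, rfl⟩
        | succ k ih =>
          intro hkn
          obtain ⟨i1, i2⟩ := ih (by omega)
          obtain ⟨k1, k2⟩ := hk k (by omega)
          have u1 : SD.U Q y 1 (k + 1) = f (k + 1) := by
            have := hU 0 k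
            simp only [zero_add, hU0', i1, add_zero, sub_zero] at this
            rw [this, k1]
            simp [y]
          refine ⟨u1, ?_⟩
          have := hU 1 k
          simp only [one_add_one_eq_two, i1, i2, u1] at this
          rw [this, k2]
          simp [y]
      rcases Nat.eq_zero_or_pos n with rfl | hn
      · have h1 := bound 1 1 le_rfl (by omega) le_rfl (by omega)
        have h2 := abs_nonneg (SD.U Q y 1 1)
        rw [← fn, ← gn, f0, g0, abs_zero]
        exact ⟨by linarith, by linarith⟩
      · have h1 := bound 1 n le_rfl (by omega) hn (by omega)
        have h2 := bound 2 n (by omega) (by omega) hn (by omega)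
        rw [(hf n le_rfl).1, fn] at h1
        rw [(hf n le_rfl).2, gn] at h2
        exact ⟨h1, h2⟩
    obtain ⟨n, y1, y2, f, g, h1, h2, h3, h4, h5, h6, h7⟩ := h.path hab.le
    exact main r s n y1 y2 f g h1 h2 h3 h4 h5 h6 h7
  have hK0 : 0 ≤ Ctil := by
    have := (stab 0 0 SD.Reach.zero).1
    simpa using this
  have hK : ((2 : ℝ) ^ d - 3) * (2 * Ctil) < b - a := by
    rw [hC, lt_div_iff₀ (by linarith)] at hlt
    linarith
  have S : SD.Sys a b Ctil A Q :=
    { mem := hQ1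
      near := hQ2
      stab := stab
      len := by nlinarith
      hab := hab }
  exact S.false hM hcard (by push_cast; exact hK)
end

section
/- Let $\beta\in\{1,2\}$ and let $r\geq\beta$ be an integer. Let $x\in[0,1]^N$ satisfy $\|(D^{\beta})^T x\|_0\leq s$, and let $q\in\mathbb{R}^N$ satisfy the Sigma Delta stability relation $\|D^{-r}(x-q)\|_\infty\leq\delta/2$ for some $\delta>0$. Let $\hat{x}$ be any minimizer of $\|(D^{\beta})^T z\|_1$ over all $z\in\mathbb{R}^N$ with $\|D^{-r}(z-q)\|_\infty\leq\delta/2$. Then $\|\hat{x}-x\|_2\leq\sqrt{2^{2r+1}s}\,\delta$; in particular $\|\hat{x}-x\|_2\leq C\sqrt{s}\,\delta$ with a constant $C$ depending only on $r$ and not on $x$ or $N$. -/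
open scoped BigOperators
open Finset Matrix

/-- The `N × N` finite difference matrix with `1`s on the diagonal and `-1`s on
the subdiagonal. -/
noncomputable def Dmat (N : ℕ) : Matrix (Fin N) (Fin N) ℝ :=
  Matrix.of fun i j => if i = j then 1 else if (j : ℕ) + 1 = (i : ℕ) then -1 else 0

/-- Entrywise ℓ¹ norm of a vector. -/
noncomputable def l1 {N : ℕ} (v : Fin N → ℝ) : ℝ := ∑ i, |v i|

/-- Euclidean norm of a vector. -/
noncomputable def l2 {N : ℕ} (v : Fin N → ℝ) : ℝ := Real.sqrt (∑ i, (v i) ^ 2)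

/-- Number of nonzero entries of a vector (the "ℓ⁰ norm"). -/
noncomputable def sparsity {N : ℕ} (v : Fin N → ℝ) : ℕ :=
  (Finset.univ.filter (fun i => v i ≠ 0)).card

theorem Dmat_det (N : ℕ) : (Dmat N).det = 1 := by
  rw [Matrix.det_of_lowerTriangular]
  · simp [Dmat]
  · intro i j hij
    have hij' : i < j := hij
    have h1 : i ≠ j := ne_of_lt hij'
    have h2 : ¬ ((j : ℕ) + 1 = (i : ℕ)) := by
      have : (i : ℕ) < j := hij'
      omega
    simp [Dmat, h1, h2]

theorem Dmat_abs_le {N : ℕ} (i j : Fin N) :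
    |Dmat N i j| ≤ (if i = j then (1 : ℝ) else 0) + (if (j : ℕ) + 1 = (i : ℕ) then 1 else 0) := by
  unfold Dmat
  simp only [Matrix.of_apply]
  split_ifs <;> norm_num

theorem Dmat_row {N : ℕ} (i : Fin N) : ∑ j, |Dmat N i j| ≤ 2 := by
  have h2 : ∑ j : Fin N, (if (j : ℕ) + 1 = (i : ℕ) then (1 : ℝ) else 0) ≤ 1 := by
    rw [Finset.sum_boole]
    have : (Finset.univ.filter (fun j : Fin N => (j : ℕ) + 1 = (i : ℕ))).card ≤ 1 := by
      rw [Finset.card_le_one]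
      intro a ha b hb
      simp only [Finset.mem_filter, Finset.mem_univ, true_and] at ha hb
      apply Fin.ext
      omega
    exact_mod_cast this
  have h1 : ∑ j : Fin N, (if i = j then (1 : ℝ) else 0) = 1 := by simp
  have h := Finset.sum_le_sum (fun j (_ : j ∈ Finset.univ) => Dmat_abs_le i j)
  rw [Finset.sum_add_distrib, h1] at h
  linarith

theorem Dmat_col {N : ℕ} (j : Fin N) : ∑ i, |(Dmat N)ᵀ j i| ≤ 2 := by
  have h2 : ∑ i : Fin N, (if (j : ℕ) + 1 = (i : ℕ) then (1 : ℝ) else 0) ≤ 1 := by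
    rw [Finset.sum_boole]
    have : (Finset.univ.filter (fun i : Fin N => (j : ℕ) + 1 = (i : ℕ))).card ≤ 1 := by
      rw [Finset.card_le_one]
      intro a ha b hb
      simp only [Finset.mem_filter, Finset.mem_univ, true_and] at ha hb
      apply Fin.ext
      omega
    exact_mod_cast this
  have h1 : ∑ i : Fin N, (if i = j then (1 : ℝ) else 0) = 1 := by simp
  have h := Finset.sum_le_sum (fun i (_ : i ∈ Finset.univ) => Dmat_abs_le i j)
  rw [Finset.sum_add_distrib, h1] at h
  simp only [Matrix.transpose_apply]
  linarith

theorem mulVec_bound {N : ℕ} (A : Matrix (Fin N) (Fin N) ℝ) (hA : ∀ i, ∑ j, |A i j| ≤ 2)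
    (v : Fin N → ℝ) (c : ℝ) (hc : 0 ≤ c) (hv : ∀ i, |v i| ≤ c) (i : Fin N) :
    |(A *ᵥ v) i| ≤ 2 * c := by
  calc |(A *ᵥ v) i| = |∑ j, A i j * v j| := rfl
    _ ≤ ∑ j, |A i j * v j| := Finset.abs_sum_le_sum_abs _ _
    _ ≤ ∑ j, |A i j| * c := by
        apply Finset.sum_le_sum
        intro j _
        rw [abs_mul]
        exact mul_le_mul_of_nonneg_left (hv j) (abs_nonneg _)
    _ = (∑ j, |A i j|) * c := by rw [Finset.sum_mul]
    _ ≤ 2 * c := mul_le_mul_of_nonneg_right (hA i) hc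

theorem pow_mulVec_bound {N : ℕ} (A : Matrix (Fin N) (Fin N) ℝ) (hA : ∀ i, ∑ j, |A i j| ≤ 2)
    (v : Fin N → ℝ) (c : ℝ) (hc : 0 ≤ c) (hv : ∀ i, |v i| ≤ c) (k : ℕ) :
    ∀ i, |((A ^ k) *ᵥ v) i| ≤ 2 ^ k * c := by
  induction k with
  | zero => intro i; simpa using hv i
  | succ k ih =>
    intro i
    rw [pow_succ', ← Matrix.mulVec_mulVec]
    have := mulVec_bound A hA _ (2 ^ k * c) (by positivity) ih i
    rw [pow_succ']
    linarith

/-- The cone estimate for an `ℓ¹` minimizer. -/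
theorem cone_bound {N : ℕ} (a b : Fin N → ℝ) (s : ℕ) (M : ℝ) (hM : 0 ≤ M)
    (hs : sparsity a ≤ s) (hab : l1 b ≤ l1 a) (hM' : ∀ i, |b i - a i| ≤ M) :
    ∑ i, |b i - a i| ≤ 2 * (s * M) := by
  have key : ∀ i, |b i - a i| ≤ |b i| - |a i| + (if a i ≠ 0 then 2 * M else 0) := by
    intro i
    by_cases h : a i = 0
    · simp [h]
    · rw [if_pos h]
      have h1 := hM' i
      have h2 := abs_sub_abs_le_abs_sub (a i) (b i)
      rw [abs_sub_comm] at h2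
      linarith
  have h := Finset.sum_le_sum (fun i (_ : i ∈ Finset.univ) => key i)
  rw [Finset.sum_add_distrib, Finset.sum_sub_distrib, ← Finset.sum_filter,
    Finset.sum_const, nsmul_eq_mul] at h
  unfold l1 at hab
  have h3 : (((Finset.univ.filter (fun i => a i ≠ 0)).card : ℕ) : ℝ) ≤ s := by
    exact_mod_cast hs
  have h4 := mul_le_mul_of_nonneg_right h3 hM
  linarith

/-- error bound `‖x̂ - x‖₂ ≤ √(2^{2r+1} s) δ` for the TV-norm
minimizing decoder applied to an `r`-th order Sigma Delta quantization of a
signal `x` with `s`-sparse `β`-th order differences. -/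
theorem sigma_delta_tv_decoder_error
    (N β r s : ℕ) (hβ : β = 1 ∨ β = 2) (hβr : β ≤ r)
    (δ : ℝ) (hδ : 0 < δ)
    (x q : Fin N → ℝ)
    (hx : ∀ i, x i ∈ Set.Icc (0 : ℝ) 1)
    (hsparse : sparsity (((Dmat N ^ β)ᵀ).mulVec x) ≤ s)
    (hxfeas : ∀ i, |(((Dmat N)⁻¹ ^ r).mulVec (x - q)) i| ≤ δ / 2)
    (xhat : Fin N → ℝ)
    (hxhatfeas : ∀ i, |(((Dmat N)⁻¹ ^ r).mulVec (xhat - q)) i| ≤ δ / 2)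
    (hmin : ∀ z : Fin N → ℝ,
      (∀ i, |(((Dmat N)⁻¹ ^ r).mulVec (z - q)) i| ≤ δ / 2) →
      l1 (((Dmat N ^ β)ᵀ).mulVec xhat) ≤ l1 (((Dmat N ^ β)ᵀ).mulVec z)) :
    l2 (xhat - x) ≤ Real.sqrt (2 ^ (2 * r + 1) * s) * δ := by
  have hunit : IsUnit (Dmat N).det := by rw [Dmat_det]; exact isUnit_one
  set h : Fin N → ℝ := xhat - x with hh
  set u : Fin N → ℝ := ((Dmat N)⁻¹ ^ r) *ᵥ h with hu
  have hub : ∀ i, |u i| ≤ δ := by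
    intro i
    have e : u = ((Dmat N)⁻¹ ^ r) *ᵥ (xhat - q) - ((Dmat N)⁻¹ ^ r) *ᵥ (x - q) := by
      rw [← Matrix.mulVec_sub, hu, hh]
      congr 1
      abel
    rw [e, Pi.sub_apply]
    have h1 := abs_le.mp (hxfeas i)
    have h2 := abs_le.mp (hxhatfeas i)
    rw [abs_le]
    constructor <;> linarith [h1.1, h1.2, h2.1, h2.2]
  have hDu : (Dmat N ^ r) *ᵥ u = h := by
    rw [hu, Matrix.mulVec_mulVec, Matrix.inv_pow', Matrix.mul_nonsing_inv, Matrix.one_mulVec]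
    rw [Matrix.det_pow]
    exact hunit.pow r
  have hhb : ∀ i, |h i| ≤ 2 ^ r * δ := by
    rw [← hDu]
    exact pow_mulVec_bound _ Dmat_row u δ hδ.le hub r
  have hwb : ∀ i, |(((Dmat N ^ β)ᵀ) *ᵥ h) i| ≤ 2 ^ β * (2 ^ r * δ) := by
    rw [Matrix.transpose_pow]
    exact pow_mulVec_bound _ Dmat_col h _ (by positivity) hhb β
  have hgb := pow_mulVec_bound _ Dmat_row u δ hδ.le hub (r - β)
  have hw : ∀ i, (((Dmat N ^ β)ᵀ) *ᵥ h) i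
      = (((Dmat N ^ β)ᵀ) *ᵥ xhat) i - (((Dmat N ^ β)ᵀ) *ᵥ x) i := by
    intro i
    rw [hh, Matrix.mulVec_sub, Pi.sub_apply]
  have hcone := cone_bound _ _ s (2 ^ β * (2 ^ r * δ)) (by positivity) hsparse (hmin x hxfeas)
    (fun i => by rw [← hw i]; exact hwb i)
  simp only [← hw] at hcone
  have hdot : ∑ i, h i ^ 2
      = ∑ i, (((Dmat N ^ β)ᵀ) *ᵥ h) i * ((Dmat N ^ (r - β)) *ᵥ u) i := by
    have e1 : h ⬝ᵥ h = (((Dmat N ^ β)ᵀ) *ᵥ h) ⬝ᵥ ((Dmat N ^ (r - β)) *ᵥ u) := by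
      rw [Matrix.mulVec_transpose, ← Matrix.dotProduct_mulVec, Matrix.mulVec_mulVec, ← pow_add,
        Nat.add_sub_cancel' hβr, hDu]
    simpa [dotProduct, sq] using e1
  have hfin : ∑ i, h i ^ 2 ≤ (2 ^ (2 * r + 1) * s) * δ ^ 2 := by
    rw [hdot]
    calc _ ≤ ∑ i, |(((Dmat N ^ β)ᵀ) *ᵥ h) i| * (2 ^ (r - β) * δ) := by
          apply Finset.sum_le_sum
          intro i _
          refine (le_abs_self _).trans ?_
          rw [abs_mul]
          exact mul_le_mul_of_nonneg_left (hgb i) (abs_nonneg _)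
      _ = (∑ i, |(((Dmat N ^ β)ᵀ) *ᵥ h) i|) * (2 ^ (r - β) * δ) := by rw [Finset.sum_mul]
      _ ≤ (2 * (s * (2 ^ β * (2 ^ r * δ)))) * (2 ^ (r - β) * δ) :=
          mul_le_mul_of_nonneg_right hcone (by positivity)
      _ = (2 ^ β * 2 ^ (r - β)) * (2 * 2 ^ r * s * δ ^ 2) := by ring
      _ = (2 ^ (2 * r + 1) * s) * δ ^ 2 := by
          rw [← pow_add, Nat.add_sub_cancel' hβr]
          ring
  unfold l2
  calc _ ≤ Real.sqrt ((2 ^ (2 * r + 1) * s) * δ ^ 2) := Real.sqrt_le_sqrt hfin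
    _ = _ := by rw [Real.sqrt_mul (by positivity), Real.sqrt_sq hδ.le]
end
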